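/- Let U ⊆ ℂ \ ℤ be an open set on which ω has no zeros. Define η_1(s) = ζ(s) − (2/ω(s)) ζ'(s) and η_{k+1}(s) = (ω'(s)/ω(s) − ω(s)/2) η_k(s) + η_k'(s) for k ≥ 1, as analytic functions on U. Then for every integer k ≥ 1 and every s ∈ U, one has −(1/2) ω(s) η_k(s) = Z_k(s). -/

import Mathlib

open Complex Finset

noncomputable def chi (s : ℂ) : ℂ :=
  2 ^ s * (Real.pi : ℂ) ^ (s - 1) * Complex.sin (Real.pi * s / 2) * Complex.Gamma (1 - s)

noncomputable def omega (s : ℂ) : ℂ :=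
  Real.log (2 * Real.pi) + deriv Complex.Gamma s / Complex.Gamma s
    - (Real.pi / 2) * Complex.tan (Real.pi * s / 2)

noncomputable def Zk : ℕ → ℂ → ℂ
  | 0 => riemannZeta
  | k + 1 => fun s => deriv (Zk k) s - (1 / 2) * omega s * Zk k s

noncomputable def fk : ℕ → ℂ → ℂ
  | 0 => fun _ => 1
  | k + 1 => fun s => deriv (fk k) s - (1 / 2) * omega s * fk k s

noncomputable def scrZ (k : ℕ) (T : ℝ) (s : ℂ) : ℂ :=
  ∑ μ ∈ Finset.range (k + 1),
    (k.choose μ : ℂ) * ((Real.log (T / (2 * Real.pi)) : ℂ) / 2) ^ (k - μ)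
      * iteratedDeriv μ riemannZeta s

/-- Order of vanishing of `f` at `ρ`: the least `n` with nonvanishing `n`-th derivative
(for analytic `f` this is the multiplicity of the zero). -/
noncomputable def zeroOrder (f : ℂ → ℂ) (ρ : ℂ) : ℕ :=
  sInf {n : ℕ | iteratedDeriv n f ρ ≠ 0}

/-- `etaMT (k-1)` is the function `η_k` of Matsumoto–Tanigawa:
`η_1(s) = ζ(s) − (2/ω(s)) ζ'(s)` and `η_{k+1} = (ω'/ω − ω/2) η_k + η_k'`. -/
noncomputable def etaMT : ℕ → ℂ → ℂ
  | 0 => fun s => riemannZeta s - 2 / omega s * deriv riemannZeta s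
  | k + 1 => fun s => (deriv omega s / omega s - omega s / 2) * etaMT k s + deriv (etaMT k) s

theorem differentiableAt_omega {s : ℂ} (hs : ∀ n : ℤ, s ≠ (n : ℂ)) :
    DifferentiableAt ℂ omega s := by
  have hnat : ∀ m : ℕ, s ≠ -m := fun m => by simpa using hs (-m)
  have hGamma : AnalyticAt ℂ Complex.Gamma s := by
    have hinv : AnalyticAt ℂ (fun z : ℂ => (Complex.Gamma z)⁻¹) s :=
      Complex.differentiable_one_div_Gamma.analyticAt s
    simpa using hinv.fun_inv (inv_ne_zero (Complex.Gamma_ne_zero hnat))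
  have hcos : Complex.cos (Real.pi * s / 2) ≠ 0 := by
    rw [Complex.cos_ne_zero_iff]
    intro k hk
    refine hs (2 * k + 1) ?_
    have hpi : (Real.pi : ℂ) ≠ 0 := Complex.ofReal_ne_zero.mpr Real.pi_ne_zero
    push_cast
    refine mul_left_cancel₀ hpi ?_
    linear_combination 2 * hk
  have htan : DifferentiableAt ℂ (fun z : ℂ => Complex.tan (Real.pi * z / 2)) s :=
    (Complex.differentiableAt_tan.mpr hcos).comp s (f := fun z : ℂ => Real.pi * z / 2)
      (by fun_prop)
  exact ((hGamma.deriv.differentiableAt.div hGamma.differentiableAt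
    (Complex.Gamma_ne_zero hnat)).const_add _).sub (htan.const_mul _)

theorem differentiableOn_etaMT {U : Set ℂ} (hU : IsOpen U) (hU1 : (1 : ℂ) ∉ U)
    (homega : DifferentiableOn ℂ omega U) (hUω : ∀ s ∈ U, omega s ≠ 0) (k : ℕ) :
    DifferentiableOn ℂ (etaMT k) U := by
  induction k with
  | zero =>
    have hzeta : DifferentiableOn ℂ riemannZeta U := fun z hz =>
      (differentiableAt_riemannZeta (ne_of_mem_of_not_mem hz hU1)).differentiableWithinAt
    exact hzeta.sub (((differentiableOn_const 2).div homega hUω).mul (hzeta.deriv hU))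
  | succ k ih =>
    exact ((((homega.deriv hU).div homega hUω).sub (homega.div_const 2)).mul ih).add
      (ih.deriv hU)

theorem neg_half_mul_omega_mul_etaMT_eq_Zk_succ {U : Set ℂ} (hU : IsOpen U) (hU1 : (1 : ℂ) ∉ U)
    (homega : DifferentiableOn ℂ omega U) (hUω : ∀ s ∈ U, omega s ≠ 0) (k : ℕ) :
    ∀ s ∈ U, -(1 / 2) * omega s * etaMT k s = Zk (k + 1) s := by
  induction k with
  | zero =>
    intro s hs
    have hω := hUω s hs
    simp only [etaMT, Zk]
    field_simp
    ring
  | succ k ih =>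
    intro s hs
    have hω := hUω s hs
    have hnhds := hU.mem_nhds hs
    have hderiv : deriv (Zk (k + 1)) s =
        -(1 / 2) * deriv omega s * etaMT k s + -(1 / 2) * omega s * deriv (etaMT k) s := by
      have heq : Zk (k + 1) =ᶠ[nhds s] fun z => -(1 / 2) * omega z * etaMT k z := by
        filter_upwards [hnhds] with z hz using (ih z hz).symm
      rw [heq.deriv_eq]
      exact (((homega.differentiableAt hnhds).hasDerivAt.const_mul _).mul
        ((differentiableOn_etaMT hU hU1 homega hUω k).differentiableAt hnhds).hasDerivAt).deriv
    have hZk : Zk (k + 1 + 1) s =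
        deriv (Zk (k + 1)) s - (1 / 2) * omega s * Zk (k + 1) s := rfl
    rw [hZk, hderiv, ← ih s hs, etaMT]
    field_simp
    ring

/-- on an open set `U ⊆ ℂ \ ℤ` where `ω` has no zeros,
`−(1/2) ω(s) η_k(s) = Z_k(s)` for all `k ≥ 1`. -/
theorem eta_eq_Zk (U : Set ℂ) (hU : IsOpen U) (hUZ : ∀ s ∈ U, ∀ n : ℤ, s ≠ (n : ℂ))
    (hUω : ∀ s ∈ U, omega s ≠ 0) (k : ℕ) (hk : 1 ≤ k) (s : ℂ) (hs : s ∈ U) :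
    -(1 / 2) * omega s * etaMT (k - 1) s = Zk k s := by
  obtain ⟨n, rfl⟩ := Nat.exists_eq_add_of_le' hk
  exact neg_half_mul_omega_mul_etaMT_eq_Zk_succ hU (fun h => hUZ 1 h 1 (by simp))
    (fun z hz => (differentiableAt_omega (hUZ z hz)).differentiableWithinAt) hUω n s hs
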